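/- arXiv:2505.01600 — 2 statements merged into one kernel-verified Lean document; each statement's English description precedes it below -/
import Mathlib

section
/- Under the linear panel data model with heterogeneous (random) coefficients, the instrument setup, Assumptions 1, 2 and 3, and the compact support regularity, fix e₁, e₂ ∈ ℝ^r and assume additionally the fourth-order moment restriction E( ∑_{t=1}^T (R_t'B)³ ε_t ) = 0. Then sup_{λ > 0, μ ∈ ℝ^L} E[ min_{b ∈ ℬ} { e₁'b · b'e₂ + λ ∑_{t=1}^T (R_t'b)³ (Y_t − R_t'b) + μ'S(Y − Rb) } ] ≤ E(e₁'B B'e₂) ≤ inf_{λ < 0, μ ∈ ℝ^L} E[ max_{b ∈ ℬ} { e₁'b · b'e₂ + λ ∑_{t=1}^T (R_t'b)³ (Y_t − R_t'b) + μ'S(Y − Rb) } ]. -/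
open MeasureTheory Matrix

section ContinuousObjective

variable {Ω P E : Type*} [MeasurableSpace Ω] {μ : Measure Ω} [IsProbabilityMeasure μ]
  [TopologicalSpace P] [MeasurableSpace P]
  [PseudoMetricSpace E] [MeasurableSpace E]
  [OpensMeasurableSpace (P × E)]
  {F : P × E → ℝ} {V : Ω → P} {B : Ω → E} {C : Set P} {K : Set E}

/-- A continuous function of random elements with essentially compact range is integrable. -/
theorem integrable_continuous_of_ae_mem_compact (hF : Continuous F) (hV : Measurable V)
    (hB : Measurable B) (hC : IsCompact C)
    (hK : IsCompact K) (hVC : ∀ᵐ ω ∂μ, V ω ∈ C) (hBK : ∀ᵐ ω ∂μ, B ω ∈ K) :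
    Integrable (fun ω => F (V ω, B ω)) μ := by
  obtain ⟨M, hM⟩ := (hC.prod hK).exists_bound_of_continuousOn hF.continuousOn
  refine Integrable.of_bound (hF.measurable.comp (hV.prodMk hB)).aestronglyMeasurable M ?_
  filter_upwards [hVC, hBK] with ω h1 h2
  exact hM _ ⟨h1, h2⟩

/-- The expected minimum of a continuous objective over a compact set is at most the expected
objective at any random point of that set. -/
theorem integral_iInf_le_integral_of_ae_mem_compact [OpensMeasurableSpace P]
    (hF : Continuous F) (hV : Measurable V) (hB : Measurable B) (hC : IsCompact C)
    (hK : IsCompact K) (hVC : ∀ᵐ ω ∂μ, V ω ∈ C) (hBK : ∀ᵐ ω ∂μ, B ω ∈ K) :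
    ∫ ω, (⨅ b : K, F (V ω, b.1)) ∂μ ≤ ∫ ω, F (V ω, B ω) ∂μ := by
  obtain ⟨M, hM⟩ := (hC.prod hK).exists_bound_of_continuousOn hF.continuousOn
  obtain ⟨ω₀, hω₀⟩ := hBK.exists
  have : Nonempty K := ⟨⟨_, hω₀⟩⟩
  have : CompactSpace K := isCompact_iff_compactSpace.mp hK
  have hcont : ∀ ω, Continuous fun b : K => F (V ω, b.1) := fun ω => by fun_prop
  have hbdd : ∀ ω, BddBelow (Set.range fun b : K => F (V ω, b.1)) := fun ω =>
    (isCompact_range (hcont ω)).bddBelow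
  have hmeas : Measurable fun ω => ⨅ b : K, F (V ω, b.1) := by
    obtain ⟨D, hDc, hDd⟩ := TopologicalSpace.exists_countable_dense K
    have := hDc.to_subtype
    simp_rw [← fun ω => hDd.ciInf' (hcont ω)]
    refine Measurable.iInf fun b => ?_
    have hb : Continuous fun v : P => F (v, b.1.1) := by fun_prop
    exact hb.measurable.comp hV
  have hint : Integrable (fun ω => ⨅ b : K, F (V ω, b.1)) μ := by
    refine Integrable.of_bound hmeas.aestronglyMeasurable M ?_
    filter_upwards [hVC] with ω h
    obtain ⟨b, hb⟩ := (isCompact_range (hcont ω)).sInf_mem (Set.range_nonempty _)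
    rw [iInf, ← hb]
    exact hM (V ω, b.1) ⟨h, b.2⟩
  refine integral_mono_ae hint
    (integrable_continuous_of_ae_mem_compact hF hV hB hC hK hVC hBK) ?_
  filter_upwards [hBK] with ω h
  exact ciInf_le (hbdd ω) ⟨B ω, h⟩

/-- The expected maximum of a continuous objective over a compact set is at least the expected
objective at any random point of that set. -/
theorem integral_le_integral_iSup_of_ae_mem_compact [OpensMeasurableSpace P]
    (hF : Continuous F) (hV : Measurable V) (hB : Measurable B) (hC : IsCompact C)
    (hK : IsCompact K) (hVC : ∀ᵐ ω ∂μ, V ω ∈ C) (hBK : ∀ᵐ ω ∂μ, B ω ∈ K) :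
    ∫ ω, F (V ω, B ω) ∂μ ≤ ∫ ω, (⨆ b : K, F (V ω, b.1)) ∂μ := by
  have h := integral_iInf_le_integral_of_ae_mem_compact hF.neg hV hB hC hK hVC hBK
  have hneg : ∀ ω, ⨅ b : K, -F (V ω, b.1) = -⨆ b : K, F (V ω, b.1) := fun ω => by
    have := Real.mul_iSup_of_nonpos (r := -1) (by norm_num) fun b : K => F (V ω, b.1)
    simpa using this.symm
  simp only [Pi.neg_apply, hneg, integral_neg] at h
  exact neg_le_neg_iff.mp h

end ContinuousObjective

noncomputable section

/-- **Bounds for general second moments via fourth-order moment restrictions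
(Proposition 9).** Under the dynamic random coefficient model with instruments, compact
support, and the fourth-order moment restriction `E(∑_t (R_t'B)³ ε_t) = 0`, the second
moment `E(e₁'B B'e₂)` is bounded below and above by the stated dual values. -/
theorem general_second_moment_bounds
    {T q p : ℕ} (hT : 1 ≤ T) (hqp : 1 ≤ q + p)
    {Ω : Type*} [MeasurableSpace Ω] (μ : Measure Ω) [IsProbabilityMeasure μ]
    (Z : Fin T → Ω → Fin q → ℝ) (X : Fin T → Ω → Fin p → ℝ)
    (Y : Ω → Fin T → ℝ) (B : Ω → Fin (q + p) → ℝ)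
    (hZ : ∀ t, Measurable (Z t)) (hX : ∀ t, Measurable (X t))
    (hY : Measurable Y) (hB : Measurable B)
    (R : Ω → Matrix (Fin T) (Fin (q + p)) ℝ)
    (hR : ∀ ω t, R ω t = Fin.append (Z t ω) (X t ω))
    -- Assumption 1 (sequential exogeneity)
    (hεint : ∀ t : Fin T, Integrable (fun ω => Y ω t - R ω t ⬝ᵥ B ω) μ)
    (hA1 : ∀ t : Fin T,
      μ[(fun ω => Y ω t - R ω t ⬝ᵥ B ω)|
        MeasurableSpace.comap
          (fun ω => (B ω, fun u : Fin T => Z u ω, fun u : {u : Fin T // u ≤ t} => X u.1 ω))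
          inferInstance] =ᵐ[μ] 0)
    -- Assumption 2 (no multicollinearity)
    (hA2 : ∀ᵐ ω ∂μ, ((R ω)ᵀ * R ω).PosDef)
    -- instrument setup
    (L : Fin T → ℕ) (St : (t : Fin T) → Ω → Fin (L t) → ℝ)
    (hSt : ∀ t, Measurable (St t))
    (S : Ω → Matrix ((t : Fin T) × Fin (L t)) (Fin T) ℝ)
    (hSdef : ∀ ω (pr : (t : Fin T) × Fin (L t)) (u : Fin T),
      S ω pr u = if u = pr.1 then St pr.1 ω pr.2 else 0)
    (hSεint : ∀ (t : Fin T) (i : Fin (L t)),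
      Integrable (fun ω => St t ω i * (Y ω t - R ω t ⬝ᵥ B ω)) μ)
    (hSε : ∀ (t : Fin T) (i : Fin (L t)),
      ∫ ω, St t ω i * (Y ω t - R ω t ⬝ᵥ B ω) ∂μ = 0)
    -- Assumption 3
    (hA3 : ∀ a : (t : Fin T) → Fin (L t) → ℝ, a ≠ 0 →
      0 < μ {ω | ∑ t, (St t ω ⬝ᵥ a t) • R ω t ≠ 0})
    -- compact support regularity
    (Bset : Set (Fin (q + p) → ℝ)) (hBcomp : IsCompact Bset)
    (hBsupp : ∀ᵐ ω ∂μ, B ω ∈ Bset)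
    (c : ℝ)
    (hbd : ∀ᵐ ω ∂μ, (∀ t, |Y ω t| ≤ c) ∧ (∀ t j, |R ω t j| ≤ c) ∧
      (∀ (pr : (t : Fin T) × Fin (L t)) (u : Fin T), |S ω pr u| ≤ c))
    -- fourth-order moment restriction
    (e1 e2 : Fin (q + p) → ℝ)
    (hmom4int : Integrable
      (fun ω => ∑ t, (R ω t ⬝ᵥ B ω) ^ 3 * (Y ω t - R ω t ⬝ᵥ B ω)) μ)
    (hmom4 : ∫ ω, ∑ t, (R ω t ⬝ᵥ B ω) ^ 3 * (Y ω t - R ω t ⬝ᵥ B ω) ∂μ = 0) :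
    (⨆ lam : {x : ℝ // 0 < x}, ⨆ mu : ((t : Fin T) × Fin (L t)) → ℝ,
      ∫ ω, (⨅ b : Bset,
        ((e1 ⬝ᵥ b.1) * (b.1 ⬝ᵥ e2)
          + lam.1 * ∑ t, (R ω t ⬝ᵥ b.1) ^ 3 * (Y ω t - R ω t ⬝ᵥ b.1)
          + mu ⬝ᵥ (S ω *ᵥ (Y ω - R ω *ᵥ b.1)))) ∂μ)
      ≤ ∫ ω, (e1 ⬝ᵥ B ω) * (B ω ⬝ᵥ e2) ∂μ ∧
    ∫ ω, (e1 ⬝ᵥ B ω) * (B ω ⬝ᵥ e2) ∂μ ≤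
      ⨅ lam : {x : ℝ // x < 0}, ⨅ mu : ((t : Fin T) × Fin (L t)) → ℝ,
        ∫ ω, (⨆ b : Bset,
          ((e1 ⬝ᵥ b.1) * (b.1 ⬝ᵥ e2)
            + lam.1 * ∑ t, (R ω t ⬝ᵥ b.1) ^ 3 * (Y ω t - R ω t ⬝ᵥ b.1)
            + mu ⬝ᵥ (S ω *ᵥ (Y ω - R ω *ᵥ b.1)))) ∂μ := by
  have hRm : ∀ t j, Measurable fun ω => R ω t j := by
    intro t j
    simp only [hR]
    refine Fin.addCases (fun i => ?_) (fun i => ?_) j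
    · simpa using (measurable_pi_iff.mp (hZ t)) i
    · simpa using (measurable_pi_iff.mp (hX t)) i
  have hSm : ∀ pr u, Measurable fun ω => S ω pr u := by
    intro pr u
    simp only [hSdef]
    split_ifs
    · exact (measurable_pi_iff.mp (hSt pr.1)) pr.2
    · exact measurable_const
  let V : Ω → (Fin T → ℝ) × (Fin T → Fin (q + p) → ℝ) ×
      (((t : Fin T) × Fin (L t)) → Fin T → ℝ) := fun ω => (Y ω, R ω, S ω)
  have hV : Measurable V := hY.prodMk
    ((measurable_pi_iff.mpr fun t => measurable_pi_iff.mpr (hRm t)).prodMk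
      (measurable_pi_iff.mpr fun pr => measurable_pi_iff.mpr (hSm pr)))
  let C : Set ((Fin T → ℝ) × (Fin T → Fin (q + p) → ℝ) ×
      (((t : Fin T) × Fin (L t)) → Fin T → ℝ)) :=
    (Set.univ.pi fun _ => Set.Icc (-c) c) ×ˢ
      (Set.univ.pi fun _ => Set.univ.pi fun _ => Set.Icc (-c) c) ×ˢ
      (Set.univ.pi fun _ => Set.univ.pi fun _ => Set.Icc (-c) c)
  have hC : IsCompact C :=
    (isCompact_univ_pi fun _ => isCompact_Icc).prod
      ((isCompact_univ_pi fun _ => isCompact_univ_pi fun _ => isCompact_Icc).prod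
        (isCompact_univ_pi fun _ => isCompact_univ_pi fun _ => isCompact_Icc))
  have hVC : ∀ᵐ ω ∂μ, V ω ∈ C := by
    filter_upwards [hbd] with ω h
    exact ⟨fun t _ => abs_le.mp (h.1 t), fun t _ j _ => abs_le.mp (h.2.1 t j),
      fun pr _ u _ => abs_le.mp (h.2.2 pr u)⟩
  let F : ℝ → (((t : Fin T) × Fin (L t)) → ℝ) →
      ((Fin T → ℝ) × (Fin T → Fin (q + p) → ℝ) × (((t : Fin T) × Fin (L t)) → Fin T → ℝ)) ×
        (Fin (q + p) → ℝ) → ℝ := fun lam mu x =>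
    (e1 ⬝ᵥ x.2) * (x.2 ⬝ᵥ e2)
      + lam * ∑ t, (x.1.2.1 t ⬝ᵥ x.2) ^ 3 * (x.1.1 t - x.1.2.1 t ⬝ᵥ x.2)
      + mu ⬝ᵥ (Matrix.of x.1.2.2 *ᵥ (x.1.1 - Matrix.of x.1.2.1 *ᵥ x.2))
  have hF : ∀ lam mu, Continuous (F lam mu) := by
    intro lam mu
    simp only [F, dotProduct, mulVec, Pi.sub_apply, Matrix.of_apply]
    fun_prop
  have hFV : ∀ lam mu ω b, F lam mu (V ω, b) = (e1 ⬝ᵥ b) * (b ⬝ᵥ e2)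
      + lam * ∑ t, (R ω t ⬝ᵥ b) ^ 3 * (Y ω t - R ω t ⬝ᵥ b)
      + mu ⬝ᵥ (S ω *ᵥ (Y ω - R ω *ᵥ b)) := fun _ _ _ _ => rfl
  have hgeq : ∀ (mu : ((t : Fin T) × Fin (L t)) → ℝ) ω,
      mu ⬝ᵥ (S ω *ᵥ (Y ω - R ω *ᵥ B ω)) =
        ∑ pr, mu pr * (St pr.1 ω pr.2 * (Y ω pr.1 - R ω pr.1 ⬝ᵥ B ω)) := by
    intro mu ω
    simp [dotProduct, mulVec, hSdef]
  have hFint : ∀ lam mu, ∫ ω, F lam mu (V ω, B ω) ∂μ = ∫ ω, (e1 ⬝ᵥ B ω) * (B ω ⬝ᵥ e2) ∂μ := by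
    intro lam mu
    have hi := integrable_continuous_of_ae_mem_compact (hF lam mu) hV hB hC hBcomp hVC hBsupp
    have hgi : ∀ pr : (t : Fin T) × Fin (L t), Integrable
        (fun ω => mu pr * (St pr.1 ω pr.2 * (Y ω pr.1 - R ω pr.1 ⬝ᵥ B ω))) μ :=
      fun pr => (hSεint pr.1 pr.2).const_mul _
    have hgs := integrable_finsetSum Finset.univ fun pr _ => hgi pr
    have hs := (hmom4int.const_mul lam).add hgs
    have h0 : ∫ ω, (lam * ∑ t, (R ω t ⬝ᵥ B ω) ^ 3 * (Y ω t - R ω t ⬝ᵥ B ω)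
        + ∑ pr, mu pr * (St pr.1 ω pr.2 * (Y ω pr.1 - R ω pr.1 ⬝ᵥ B ω))) ∂μ = 0 := by
      rw [integral_add (hmom4int.const_mul lam) hgs, integral_const_mul, hmom4,
        integral_finsetSum _ fun pr _ => hgi pr]
      simp [integral_const_mul, hSε]
    have hsub := integral_sub hi hs
    simp only [Pi.add_apply] at hsub
    rw [h0, sub_zero] at hsub
    rw [← hsub]
    refine integral_congr_ae (Filter.Eventually.of_forall fun ω => ?_)
    simp only [hFV, hgeq]
    ring
  have : Nonempty {x : ℝ // 0 < x} := ⟨⟨1, one_pos⟩⟩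
  have : Nonempty {x : ℝ // x < 0} := ⟨⟨-1, by norm_num⟩⟩
  constructor
  · refine ciSup_le fun lam => ciSup_le fun mu => ?_
    have h := integral_iInf_le_integral_of_ae_mem_compact (hF lam.1 mu) hV hB hC
      hBcomp hVC hBsupp
    rw [hFint] at h
    simpa only [hFV] using h
  · refine le_ciInf fun lam => le_ciInf fun mu => ?_
    have h := integral_le_integral_iSup_of_ae_mem_compact (hF lam.1 mu) hV hB hC
      hBcomp hVC hBsupp
    rw [hFint] at h
    simpa only [hFV] using h
end
end

section
/- Let 𝒲 ⊆ ℝ^{d_W} and ℬ ⊆ ℝ^{d_B} be nonempty Borel sets, let m, ψ_1,…,ψ_K : 𝒲 × ℬ → ℝ be bounded Borel measurable functions, and for each k = 1,…,K let π_k : 𝒲 × ℬ → ℝ^{d_k} be a Borel measurable map (for instance a coordinate projection selecting a subvector of (w, b)). Let (W, B) be a random element of 𝒲 × ℬ on a probability space satisfying the conditional moment restrictions E[ψ_k(W, B) | σ(π_k(W, B))] = 0 almost surely for k = 1,…,K. Then for any bounded Borel measurable functions μ_k : ℝ^{d_k} → ℝ, provided the function w ↦ inf_{b∈ℬ} [ m(w,b)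 + ∑_{k=1}^K μ_k(π_k(w,b)) ψ_k(w,b) ] is measurable and integrable with respect to the law of W, one has E[ inf_{b∈ℬ} ( m(W,b) + ∑_{k=1}^K μ_k(π_k(W,b)) ψ_k(W,b) ) ] ≤ E[m(W,B)]. -/
open MeasureTheory

noncomputable section

/-- If `E[Y | σ(X)] = 0` then `E[g(X) Y] = 0` for every measurable `g` with `g(X) Y` integrable. -/
theorem integral_comp_mul_eq_zero_of_condExp_eq_zero {Ω E : Type*} [MeasurableSpace Ω]
    [mE : MeasurableSpace E] {μ : Measure Ω} [IsFiniteMeasure μ] {X : Ω → E} {Y : Ω → ℝ}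
    {g : E → ℝ} (hX : Measurable X) (hY : Integrable Y μ) (hg : Measurable g)
    (hgY : Integrable (fun ω => g (X ω) * Y ω) μ)
    (hcond : μ[Y|MeasurableSpace.comap X mE] =ᵐ[μ] 0) :
    ∫ ω, g (X ω) * Y ω ∂μ = 0 := by
  have hgX : StronglyMeasurable[MeasurableSpace.comap X mE] (fun ω => g (X ω)) :=
    (hg.comp (comap_measurable X)).stronglyMeasurable
  have h := condExp_mul_of_stronglyMeasurable_left hgX hgY hY
  rw [← integral_condExp hX.comap_le]
  refine integral_eq_zero_of_ae (h.trans ?_)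
  filter_upwards [hcond] with ω hω
  simp [hω]

/-- **Weak duality with conditional moment restrictions.** If
`E[ψ_k(W,B) | σ(π_k(W,B))] = 0` a.s. for each `k`, then for any bounded measurable
functional Lagrange multipliers `μ_k`, optimizing out `b ∈ ℬ` yields a valid lower bound
for `E[m(W,B)]`. -/
theorem conditional_weak_duality {dW dB K : ℕ} (d : Fin K → ℕ)
    (Wset : Set (Fin dW → ℝ)) (Bset : Set (Fin dB → ℝ))
    (hWne : Wset.Nonempty) (hBne : Bset.Nonempty)
    (hWmeas : MeasurableSet Wset) (hBmeas : MeasurableSet Bset)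
    (m : (Fin dW → ℝ) × (Fin dB → ℝ) → ℝ)
    (ψ : Fin K → (Fin dW → ℝ) × (Fin dB → ℝ) → ℝ)
    (hm : Measurable m) (hmbd : ∃ c, ∀ x ∈ Wset ×ˢ Bset, |m x| ≤ c)
    (hψ : ∀ k, Measurable (ψ k)) (hψbd : ∀ k, ∃ c, ∀ x ∈ Wset ×ˢ Bset, |ψ k x| ≤ c)
    (π : (k : Fin K) → ((Fin dW → ℝ) × (Fin dB → ℝ)) → (Fin (d k) → ℝ))
    (hπ : ∀ k, Measurable (π k))
    {Ω : Type*} [MeasurableSpace Ω] (μ : Measure Ω) [IsProbabilityMeasure μ]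
    (WB : Ω → (Fin dW → ℝ) × (Fin dB → ℝ)) (hWB : Measurable WB)
    (hsupp : ∀ᵐ ω ∂μ, WB ω ∈ Wset ×ˢ Bset)
    -- conditional moment restrictions
    (hcond : ∀ k, μ[(fun ω => ψ k (WB ω))|
      MeasurableSpace.comap (fun ω => π k (WB ω)) inferInstance] =ᵐ[μ] 0)
    -- functional Lagrange multipliers
    (mul : (k : Fin K) → (Fin (d k) → ℝ) → ℝ)
    (hmul : ∀ k, Measurable (mul k)) (hmulbd : ∀ k, ∃ c, ∀ v, |mul k v| ≤ c)
    -- regularity of the dual integrand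
    (hLmeas : Measurable (fun w : Fin dW → ℝ =>
      ⨅ b : Bset, (m (w, b.1) + ∑ k, mul k (π k (w, b.1)) * ψ k (w, b.1))))
    (hLint : Integrable (fun w : Fin dW → ℝ =>
        ⨅ b : Bset, (m (w, b.1) + ∑ k, mul k (π k (w, b.1)) * ψ k (w, b.1)))
      (μ.map (fun ω => (WB ω).1))) :
    ∫ w, (⨅ b : Bset, (m (w, b.1) + ∑ k, mul k (π k (w, b.1)) * ψ k (w, b.1)))
        ∂(μ.map (fun ω => (WB ω).1)) ≤ ∫ ω, m (WB ω) ∂μ := by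
  have hint : ∀ f : (Fin dW → ℝ) × (Fin dB → ℝ) → ℝ, Measurable f →
      (∃ c, ∀ x ∈ Wset ×ˢ Bset, |f x| ≤ c) → Integrable (fun ω => f (WB ω)) μ := by
    rintro f hf ⟨c, hc⟩
    refine Integrable.of_bound (hf.comp hWB).aestronglyMeasurable c ?_
    filter_upwards [hsupp] with ω hω using hc _ hω
  have hmulψ_bd : ∀ k, ∃ c, ∀ x ∈ Wset ×ˢ Bset, |mul k (π k x) * ψ k x| ≤ c := by
    intro k
    obtain ⟨a, ha⟩ := hmulbd k
    obtain ⟨c, hc⟩ := hψbd k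
    refine ⟨a * c, fun x hx => ?_⟩
    rw [abs_mul]
    exact mul_le_mul (ha _) (hc x hx) (abs_nonneg _) ((abs_nonneg _).trans (ha (π k x)))
  have hmulψ_int : ∀ k, Integrable (fun ω => mul k (π k (WB ω)) * ψ k (WB ω)) μ := fun k =>
    hint (fun x => mul k (π k x) * ψ k x) (((hmul k).comp (hπ k)).mul (hψ k)) (hmulψ_bd k)
  have hm_int := hint m hm hmbd
  have hsum_int : Integrable (fun ω => ∑ k, mul k (π k (WB ω)) * ψ k (WB ω)) μ :=
    integrable_finsetSum _ fun k _ => hmulψ_int k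
  have hL_bdd : ∀ w ∈ Wset, BddBelow (Set.range fun b : Bset =>
      m (w, b.1) + ∑ k, mul k (π k (w, b.1)) * ψ k (w, b.1)) := by
    intro w hw
    obtain ⟨c, hc⟩ := hmbd
    choose a ha using hmulψ_bd
    refine ⟨-c + ∑ k, -a k, ?_⟩
    rintro _ ⟨b, rfl⟩
    have hwb : (w, b.1) ∈ Wset ×ˢ Bset := ⟨hw, b.2⟩
    exact add_le_add (neg_le_of_abs_le (hc _ hwb))
      (Finset.sum_le_sum fun k _ => neg_le_of_abs_le (ha k _ hwb))
  have hW : Measurable fun ω => (WB ω).1 := hWB.fst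
  calc _ = ∫ ω, (⨅ b : Bset, (m ((WB ω).1, b.1) +
          ∑ k, mul k (π k ((WB ω).1, b.1)) * ψ k ((WB ω).1, b.1))) ∂μ :=
        integral_map hW.aemeasurable hLmeas.aestronglyMeasurable
    _ ≤ ∫ ω, (m (WB ω) + ∑ k, mul k (π k (WB ω)) * ψ k (WB ω)) ∂μ := by
        refine integral_mono_ae (hLint.comp_measurable hW) (hm_int.add hsum_int) ?_
        filter_upwards [hsupp] with ω hω
        exact ciInf_le (hL_bdd _ hω.1) ⟨(WB ω).2, hω.2⟩
    _ = ∫ ω, m (WB ω) ∂μ := by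
        rw [integral_add hm_int hsum_int, integral_finsetSum _ fun k _ => hmulψ_int k,
          Finset.sum_eq_zero, add_zero]
        intro k _
        exact integral_comp_mul_eq_zero_of_condExp_eq_zero ((hπ k).comp hWB)
          (hint (ψ k) (hψ k) (hψbd k)) (hmul k) (hmulψ_int k) (hcond k)
end
end
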